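/- Let a and b be positive real numbers. Then the Lebesgue integral over the square [−1,1]² of the function (x,y) ↦ (ax² + by²)^{−1/2} (defined away from the origin) equals 4·( arsinh(√(a/b))/√a + arsinh(√(b/a))/√b ). -/

import Mathlib

open Real MeasureTheory

theorem arsinh_div_eq_log_sub_log {x y : ℝ} (hy : 0 < y) :
    arsinh (x / y) = log (x + √(y ^ 2 + x ^ 2)) - log y := by
  have h : 1 + (x / y) ^ 2 = (y ^ 2 + x ^ 2) / y ^ 2 := by field_simp
  have hS : 0 < x + √(y ^ 2 + x ^ 2) := by
    have : |x| < √(y ^ 2 + x ^ 2) := by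
      rw [← sqrt_sq_eq_abs]
      exact sqrt_lt_sqrt (sq_nonneg x) (by nlinarith)
    linarith [neg_abs_le x]
  rw [arsinh, h, sqrt_div' _ (sq_nonneg y), sqrt_sq hy.le, ← add_div, log_div hS.ne' hy.ne']

theorem hasDerivAt_arsinh_mul_div {q r : ℝ} (hq : 0 < q) (hr : 0 < r) (y : ℝ) :
    HasDerivAt (fun y => arsinh (q * y / r) / q) ((r ^ 2 + q ^ 2 * y ^ 2) ^ (-(1 : ℝ) / 2)) y := by
  have h := (((hasDerivAt_id y).const_mul q).div_const r).arsinh.div_const q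
  refine h.congr_deriv ?_
  have h1 : 1 + (q * id y / r) ^ 2 = (r ^ 2 + q ^ 2 * y ^ 2) / r ^ 2 := by
    simp only [id]; field_simp
  have hpos : 0 < r ^ 2 + q ^ 2 * y ^ 2 := by positivity
  rw [h1, sqrt_div' _ (sq_nonneg r), sqrt_sq hr.le, neg_div, rpow_neg hpos.le, ← sqrt_eq_rpow]
  have := sqrt_pos.2 hpos
  simp only [smul_eq_mul]
  field_simp

theorem continuous_rpow_neg_half {q r : ℝ} (hr : 0 < r) :
    Continuous fun y : ℝ => (r ^ 2 + q ^ 2 * y ^ 2) ^ (-(1 : ℝ) / 2) := by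
  refine Continuous.rpow_const (by fun_prop) fun y => Or.inl ?_
  positivity

theorem integral_rpow_neg_half {q r : ℝ} (hq : 0 < q) (hr : 0 < r) :
    ∫ y in (-1 : ℝ)..1, (r ^ 2 + q ^ 2 * y ^ 2) ^ (-(1 : ℝ) / 2) =
      2 / q * (log (q + √(r ^ 2 + q ^ 2)) - log r) := by
  rw [intervalIntegral.integral_eq_sub_of_hasDerivAt
    (fun y _ => hasDerivAt_arsinh_mul_div hq hr y)
    ((continuous_rpow_neg_half hr).intervalIntegrable _ _), ← arsinh_div_eq_log_sub_log hr]
  rw [mul_neg_one, neg_div, arsinh_neg, mul_one]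
  ring

theorem intervalIntegrable_log_sub_log {p q : ℝ} (hp : 0 < p) (hq : 0 < q) (s t : ℝ) :
    IntervalIntegrable (fun x => log (q + √(p ^ 2 * x ^ 2 + q ^ 2)) - (log p + log x))
      volume s t := by
  refine IntervalIntegrable.sub (Continuous.intervalIntegrable ?_ _ _)
    (intervalIntegrable_const.add intervalIntegral.intervalIntegrable_log')
  refine Continuous.log (by fun_prop) fun x => ?_
  positivity

theorem integral_log_sub_log {p q : ℝ} (hp : 0 < p) (hq : 0 < q) :
    ∫ x in (-1 : ℝ)..1, (log (q + √(p ^ 2 * x ^ 2 + q ^ 2)) - (log p + log x)) =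
      2 * (arsinh (q / p) + q / p * arsinh (p / q)) := by
  have key := integral_eq_of_hasDerivAt_off_countable
    (f := fun x => x * log (q + √(p ^ 2 * x ^ 2 + q ^ 2)) - (x * log p + x * log x) +
      q / p * arsinh (p * x / q))
    (f' := fun x => log (q + √(p ^ 2 * x ^ 2 + q ^ 2)) - (log p + log x))
    (a := -1) (b := 1) (s := {0}) (Set.countable_singleton 0) ?_ ?_
    (intervalIntegrable_log_sub_log hp hq _ _)
  · rw [key, arsinh_div_eq_log_sub_log hp]
    simp only [log_neg_eq_log, log_one, mul_neg_one, neg_div, arsinh_neg, mul_one, one_pow,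
      neg_sq]
    ring
  · have hlog : Continuous fun x : ℝ => log (q + √(p ^ 2 * x ^ 2 + q ^ 2)) :=
      Continuous.log (by fun_prop) fun x => by positivity
    have := continuous_mul_log
    have : Continuous fun x : ℝ => arsinh (p * x / q) := Continuous.arsinh (by fun_prop)
    fun_prop
  · rintro x ⟨-, hx⟩
    have hx : x ≠ 0 := hx
    have hT : 0 < p ^ 2 * x ^ 2 + q ^ 2 := by positivity
    have hS := sqrt_pos.2 hT
    have hS2 := sq_sqrt hT.le
    have h1 : HasDerivAt (fun x : ℝ => p ^ 2 * x ^ 2 + q ^ 2) (p ^ 2 * (2 * x)) x := by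
      simpa using ((hasDerivAt_pow 2 x).const_mul (p ^ 2)).add_const (q ^ 2)
    have h2 := ((h1.sqrt hT.ne').const_add q).log (by positivity)
    have h3 := (((hasDerivAt_id x).const_mul p).div_const q).arsinh.const_mul (q / p)
    have h := (((hasDerivAt_id x).mul h2).sub
      (((hasDerivAt_id x).mul_const (log p)).add (hasDerivAt_mul_log hx))).add h3
    refine h.congr_deriv ?_
    have h4 : 1 + (p * id x / q) ^ 2 = (p ^ 2 * x ^ 2 + q ^ 2) / q ^ 2 := by
      simp only [id]; field_simp; ring
    rw [h4, sqrt_div' _ (sq_nonneg q), sqrt_sq hq.le]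
    simp only [id, smul_eq_mul]
    set S := √(p ^ 2 * x ^ 2 + q ^ 2)
    have : q + S ≠ 0 := by positivity
    field_simp
    linear_combination (-1) * hS2

/-- Equation (6.21): the Leray integral for the conic `ax² + by² = u²v³`. -/
theorem leray_integral_binary_form (a b : ℝ) (ha : 0 < a) (hb : 0 < b) :
    ∫ q in (Set.Icc (-1 : ℝ) 1) ×ˢ (Set.Icc (-1 : ℝ) 1),
        (a * q.1 ^ 2 + b * q.2 ^ 2) ^ (-(1 : ℝ) / 2)
      = 4 * (arsinh (Real.sqrt (a / b)) / Real.sqrt a +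
          arsinh (Real.sqrt (b / a)) / Real.sqrt b) := by
  rw [sqrt_div ha.le, sqrt_div hb.le]
  obtain ⟨p, hp, rfl⟩ : ∃ p : ℝ, 0 < p ∧ a = p ^ 2 := ⟨√a, sqrt_pos.2 ha, (sq_sqrt ha.le).symm⟩
  obtain ⟨q, hq, rfl⟩ : ∃ q : ℝ, 0 < q ∧ b = q ^ 2 := ⟨√b, sqrt_pos.2 hb, (sq_sqrt hb.le).symm⟩
  rw [sqrt_sq hp.le, sqrt_sq hq.le]
  have hslice (x : ℝ) (y : ℝ) : p ^ 2 * x ^ 2 + q ^ 2 * y ^ 2 = (p * |x|) ^ 2 + q ^ 2 * y ^ 2 := by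
    rw [mul_pow, sq_abs]
  have hinner (x : ℝ) (hx : x ≠ 0) :
      ∫ y in Set.Icc (-1 : ℝ) 1, (p ^ 2 * x ^ 2 + q ^ 2 * y ^ 2) ^ (-(1 : ℝ) / 2) =
        2 / q * (log (q + √(p ^ 2 * x ^ 2 + q ^ 2)) - (log p + log x)) := by
    simp only [hslice]
    rw [integral_Icc_eq_integral_Ioc, ← intervalIntegral.integral_of_le (by norm_num),
      integral_rpow_neg_half hq (by positivity), log_mul hp.ne' (abs_ne_zero.2 hx), log_abs,
      mul_pow, sq_abs]
  have hne : ∀ᵐ x ∂(volume.restrict (Set.Icc (-1 : ℝ) 1)), x ≠ 0 :=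
    ae_restrict_of_ae (Measure.ae_ne volume 0)
  have hK := (intervalIntegrable_iff_integrableOn_Icc_of_le (by norm_num)).1
    ((intervalIntegrable_log_sub_log hp hq (-1) 1).const_mul (2 / q))
  have hint : IntegrableOn
      (fun z : ℝ × ℝ => (p ^ 2 * z.1 ^ 2 + q ^ 2 * z.2 ^ 2) ^ (-(1 : ℝ) / 2))
      (Set.Icc (-1 : ℝ) 1 ×ˢ Set.Icc (-1 : ℝ) 1) := by
    rw [IntegrableOn, Measure.volume_eq_prod, ← Measure.prod_restrict,
      integrable_prod_iff (Measurable.pow_const (by fun_prop) _).aestronglyMeasurable]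
    constructor
    · filter_upwards [hne] with x hx
      simp only [hslice]
      exact (continuous_rpow_neg_half (by positivity)).integrableOn_Icc
    · refine hK.congr ?_
      filter_upwards [hne] with x hx
      rw [← hinner x hx]
      congr 1 with y
      exact (norm_of_nonneg (by positivity)).symm
  rw [Measure.volume_eq_prod, setIntegral_prod _ hint,
    integral_congr_ae (hne.mono hinner), integral_Icc_eq_integral_Ioc,
    ← intervalIntegral.integral_of_le (by norm_num), intervalIntegral.integral_const_mul,
    integral_log_sub_log hp hq]
  field_simp
  ring
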